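/- Let n ≥ 3 be even and let D_n be the configuration of 3n+1 agents with x(i) = -1/n for 1 ≤ i ≤ n, x(i) = i - (n+1) for n+1 ≤ i ≤ 2n+1, and x(i) = n + 1/n for 2n+2 ≤ i ≤ 3n+1. Under the HK-dynamics with confidence bound 1, there is an absolute constant c₃ > 0 such that D_n is not frozen at any time t ≤ c₃·n²; hence f₁(m) = Ω(m²). -/

import Mathlib

open scoped Classical

/-- One step of the Hegselmann–Krause dynamics with confidence bound `1`. -/
noncomputable def hkStep {n : ℕ} (x : Fin n → ℝ) : Fin n → ℝ := fun i =>
  (∑ j ∈ Finset.univ.filter (fun j => |x j - x i| ≤ 1), x j) /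
    ((Finset.univ.filter (fun j => |x j - x i| ≤ 1)).card : ℝ)

/-- The position, among the `n + 3` distinct opinions of the dumbbell in increasing order, of the
opinion held by agent `i`. -/
def dumbbellRank (n i : ℕ) : ℕ :=
  if i < n then 0 else if i ≤ 2 * n then i - n + 1 else n + 2

/-- One step of the averaging dynamics on the dumbbell graph, for the distinct opinions
`y 0, …, y (n + 2)`, where `y 0` and `y (n + 2)` are each held by `n` agents. -/
noncomputable def dumbbellStep (n : ℕ) (y : ℕ → ℝ) (k : ℕ) : ℝ :=
  if k = 0 then (n * y 0 + y 1) / (n + 1)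
  else if k = 1 then (n * y 0 + y 1 + y 2) / (n + 2)
  else if k = n + 1 then (y n + y (n + 1) + n * y (n + 2)) / (n + 2)
  else if k = n + 2 then (y (n + 1) + n * y (n + 2)) / (n + 1)
  else (y (k - 1) + y k + y (k + 1)) / 3

/-- A supersolution for the deficits `1 - (y (k + 1) - y k)` of the gaps of the dumbbell. -/
noncomputable def deficitBound (N s k : ℝ) : ℝ :=
  2 * s / N ^ 3 + 3 / N ^ 3 * (k - (N + 1) / 2) ^ 2

/-- The gaps of `y` are at most their initial values, by an amount controlled by
`deficitBound` at time `s`. -/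
structure GapsControlled (n : ℕ) (s : ℝ) (y : ℕ → ℝ) : Prop where
  left_nonneg : 0 ≤ 1 - n * (y 1 - y 0)
  left_le : 1 - n * (y 1 - y 0) ≤ deficitBound n s 1 + 1 / n
  right_nonneg : 0 ≤ 1 - n * (y (n + 2) - y (n + 1))
  right_le : 1 - n * (y (n + 2) - y (n + 1)) ≤ deficitBound n s 1 + 1 / n
  nonneg : ∀ k, 1 ≤ k → k ≤ n → 0 ≤ 1 - (y (k + 1) - y k)
  le : ∀ k, 1 ≤ k → k ≤ n → 1 - (y (k + 1) - y k) ≤ deficitBound n s k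

lemma deficitBound_nonneg {N s k : ℝ} (hN : 0 < N) (hs : 0 ≤ s) : 0 ≤ deficitBound N s k := by
  unfold deficitBound; positivity

lemma deficitBound_self (N s : ℝ) : deficitBound N s N = deficitBound N s 1 := by
  unfold deficitBound; ring

lemma deficitBound_average {N s k : ℝ} :
    (deficitBound N s (k - 1) + deficitBound N s k + deficitBound N s (k + 1)) / 3
      = deficitBound N (s + 1) k := by
  unfold deficitBound; ring

lemma deficitBound_add_one {N s k : ℝ} :
    deficitBound N (s + 1) k = deficitBound N s k + 2 / N ^ 3 := by
  unfold deficitBound; ring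

lemma deficitBound_two {N s : ℝ} :
    deficitBound N s 2 = deficitBound N s 1 + 3 * (2 - N) / N ^ 3 := by
  unfold deficitBound; ring

lemma deficitBound_le {N s k : ℝ} (hN : 10 ≤ N) (hs : s ≤ 1 / 100 * N ^ 2)
    (hk : 1 ≤ k) (hkN : k ≤ N) : deficitBound N s k ≤ 77 / 100 / N := by
  have hN0 : 0 < N := by linarith
  have hsq : (k - (N + 1) / 2) ^ 2 ≤ N ^ 2 / 4 := by nlinarith
  have : deficitBound N s k = (2 * s + 3 * (k - (N + 1) / 2) ^ 2) / N ^ 3 := by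
    unfold deficitBound; ring
  rw [this, div_le_div_iff₀ (by positivity) hN0]
  nlinarith [mul_le_mul_of_nonneg_right hs hN0.le, mul_le_mul_of_nonneg_right hsq hN0.le]

/-- The deficit recursion at an end of the path, for the gap next to the cluster. -/
lemma end_deficit_le {N s d e f : ℝ} (hN : 0 < N)
    (hd : d ≤ deficitBound N s 1 + 1 / N) (he : e ≤ deficitBound N s 1)
    (hs : 0 ≤ s)
    (hf : f = N / ((N + 1) * (N + 2)) * d + N / (N + 2) * e + 1 / (N + 1)) :
    f ≤ deficitBound N (s + 1) 1 + 1 / N := by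
  have hB := deficitBound_nonneg (k := 1) hN hs
  rw [deficitBound_add_one, hf]
  have h1 : N / ((N + 1) * (N + 2)) * d
      ≤ N / ((N + 1) * (N + 2)) * (deficitBound N s 1 + 1 / N) :=
    mul_le_mul_of_nonneg_left hd (by positivity)
  have h2 : N / (N + 2) * e ≤ N / (N + 2) * deficitBound N s 1 :=
    mul_le_mul_of_nonneg_left he (by positivity)
  have h3 : N / ((N + 1) * (N + 2)) * (deficitBound N s 1 + 1 / N)
      + N / (N + 2) * deficitBound N s 1 + 1 / (N + 1)
      = deficitBound N s 1 + 1 / N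
        - (deficitBound N s 1 / (N + 1) + 2 / (N * (N + 1) * (N + 2))) := by
    field_simp; ring
  have h4 : 0 ≤ deficitBound N s 1 / (N + 1) + 2 / (N * (N + 1) * (N + 2)) := by positivity
  have h5 : 0 ≤ 2 / N ^ 3 := by positivity
  linarith

/-- The deficit recursion at an end of the path, for the second gap. -/
lemma next_deficit_le {N s d e e' f : ℝ} (hN : 1 ≤ N)
    (hd : d ≤ deficitBound N s 1 + 1 / N) (he : e ≤ deficitBound N s 1)
    (he' : e' ≤ deficitBound N s 2)
    (hf : f = e' / 3 + (2 / 3 - 1 / (N + 2)) * e + 1 / (N + 2) * d) :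
    f ≤ deficitBound N (s + 1) 1 := by
  have hN0 : 0 < N := by linarith
  have hc : 1 / (N + 2) ≤ 1 / 3 := one_div_le_one_div_of_le (by norm_num) (by linarith)
  have h1 : (2 / 3 - 1 / (N + 2)) * e ≤ (2 / 3 - 1 / (N + 2)) * deficitBound N s 1 :=
    mul_le_mul_of_nonneg_left he (by linarith)
  have h2 : 1 / (N + 2) * d ≤ 1 / (N + 2) * (deficitBound N s 1 + 1 / N) :=
    mul_le_mul_of_nonneg_left hd (by positivity)
  have h3 : 1 / (N + 2) * (1 / N) ≤ 1 / N ^ 2 := by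
    rw [div_mul_div_comm, one_mul]
    exact one_div_le_one_div_of_le (by positivity) (by nlinarith)
  have h4 : 3 * (2 - N) / N ^ 3 = 6 / N ^ 3 - 3 * (1 / N ^ 2) := by field_simp; ring
  have h5 : 6 / N ^ 3 = 3 * (2 / N ^ 3) := by ring
  rw [deficitBound_two] at he'
  rw [deficitBound_add_one, hf]
  linarith

lemma GapsControlled.step {n : ℕ} (hn : 3 ≤ n) {s : ℝ} (hs : 0 ≤ s) {y : ℕ → ℝ}
    (h : GapsControlled n s y) : GapsControlled n (s + 1) (dumbbellStep n y) := by
  have hN : (3 : ℝ) ≤ n := by exact_mod_cast hn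
  have hN0 : (0 : ℝ) < n := by linarith
  have y0 : dumbbellStep n y 0 = (n * y 0 + y 1) / (n + 1) := by simp [dumbbellStep]
  have y1 : dumbbellStep n y 1 = (n * y 0 + y 1 + y 2) / (n + 2) := by simp [dumbbellStep]
  have yl : dumbbellStep n y (n + 1) = (y n + y (n + 1) + n * y (n + 2)) / (n + 2) := by
    simp [dumbbellStep, show n ≠ 0 by omega]
  have yr : dumbbellStep n y (n + 2) = (y (n + 1) + n * y (n + 2)) / (n + 1) := by
    simp [dumbbellStep]
  have yk : ∀ k, 1 ≤ k → k < n → dumbbellStep n y (k + 1) = (y k + y (k + 1) + y (k + 2)) / 3 := by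
    intro k hk hkn
    simp [dumbbellStep, show k ≠ 0 by omega, show k ≠ n by omega, show k ≠ n + 1 by omega]
  have hc : 1 / ((n : ℝ) + 2) ≤ 1 / 3 := one_div_le_one_div_of_le (by norm_num) (by linarith)
  have l0 : 1 - n * (dumbbellStep n y 1 - dumbbellStep n y 0)
      = n / ((n + 1) * (n + 2)) * (1 - n * (y 1 - y 0)) + n / (n + 2) * (1 - (y 2 - y 1))
        + 1 / (n + 1) := by
    rw [y0, y1]; field_simp; ring
  have r0 : 1 - n * (dumbbellStep n y (n + 2) - dumbbellStep n y (n + 1))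
      = n / ((n + 1) * (n + 2)) * (1 - n * (y (n + 2) - y (n + 1)))
        + n / (n + 2) * (1 - (y (n + 1) - y n)) + 1 / (n + 1) := by
    rw [yl, yr]; field_simp; ring
  have l1 : 1 - (dumbbellStep n y 2 - dumbbellStep n y 1)
      = (1 - (y 3 - y 2)) / 3 + (2 / 3 - 1 / (n + 2)) * (1 - (y 2 - y 1))
        + 1 / (n + 2) * (1 - n * (y 1 - y 0)) := by
    rw [yk 1 le_rfl (by omega), y1]; field_simp; ring
  obtain ⟨m, rfl⟩ : ∃ m, n = m + 1 := ⟨n - 1, by omega⟩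
  have r1 : 1 - (dumbbellStep (m + 1) y (m + 1 + 1) - dumbbellStep (m + 1) y (m + 1))
      = (1 - (y (m + 1) - y m)) / 3
        + (2 / 3 - 1 / ((m + 1 : ℕ) + 2)) * (1 - (y (m + 1 + 1) - y (m + 1)))
        + 1 / ((m + 1 : ℕ) + 2) * (1 - (m + 1 : ℕ) * (y (m + 1 + 2) - y (m + 1 + 1))) := by
    rw [yk m (by omega) (by omega), yl]; field_simp; ring
  have hright := h.le (m + 1) (by omega) le_rfl
  rw [deficitBound_self] at hright
  have hleft := h.le 1 le_rfl (by omega)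
  rw [Nat.cast_one] at hleft
  have hleft0 := h.nonneg 1 le_rfl (by omega)
  have hright0 := h.nonneg (m + 1) (by omega) le_rfl
  have hl0 := h.left_nonneg
  have hr0 := h.right_nonneg
  have hc' : 0 ≤ 2 / 3 - 1 / (((m + 1 : ℕ) : ℝ) + 2) := by linarith
  have interior : ∀ k, 1 ≤ k → k + 1 < m + 1 →
      1 - (dumbbellStep (m + 1) y (k + 1 + 1) - dumbbellStep (m + 1) y (k + 1))
      = ((1 - (y (k + 1) - y k)) + (1 - (y (k + 1 + 1) - y (k + 1)))
        + (1 - (y (k + 1 + 1 + 1) - y (k + 1 + 1)))) / 3 := by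
    intro k hk hkn
    rw [yk (k + 1) (by omega) hkn, yk k hk (by omega)]; ring
  refine ⟨?_, end_deficit_le hN0 h.left_le hleft hs l0, ?_,
    end_deficit_le hN0 h.right_le hright hs r0, ?_, ?_⟩
  · rw [l0]; positivity
  · rw [r0]; positivity
  · intro k hk hkn
    rcases hk.eq_or_lt with rfl | hk1
    · have := h.nonneg 2 (by omega) (by omega)
      rw [l1]; positivity
    rcases hkn.eq_or_lt with rfl | hkn1
    · have := h.nonneg m (by omega) (by omega)
      rw [r1]; positivity
    obtain ⟨k, rfl⟩ : ∃ j, k = j + 1 := ⟨k - 1, by omega⟩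
    rw [interior k (by omega) hkn1]
    linarith [h.nonneg k (by omega) (by omega), h.nonneg (k + 1) (by omega) (by omega),
      h.nonneg (k + 1 + 1) (by omega) (by omega)]
  · intro k hk hkn
    rcases hk.eq_or_lt with rfl | hk1
    · have := h.le 2 (by omega) (by omega)
      rw [Nat.cast_one]
      exact next_deficit_le (by linarith) h.left_le hleft (by exact_mod_cast this) l1
    rcases hkn.eq_or_lt with rfl | hkn1
    · have := h.le m (by omega) (by omega)
      rw [deficitBound_self]
      refine next_deficit_le (by linarith) h.right_le hright (this.trans_eq ?_) r1
      unfold deficitBound; push_cast; ring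
    obtain ⟨k, rfl⟩ : ∃ j, k = j + 1 := ⟨k - 1, by omega⟩
    rw [interior k (by omega) hkn1, ← deficitBound_average]
    have h1 := h.le k (by omega) (by omega)
    have h2 := h.le (k + 1) (by omega) (by omega)
    have h3 := h.le (k + 1 + 1) (by omega) (by omega)
    have e1 : ((k + 1 : ℕ) : ℝ) - 1 = (k : ℝ) := by push_cast; ring
    have e2 : ((k + 1 : ℕ) : ℝ) + 1 = ((k + 1 + 1 : ℕ) : ℝ) := by push_cast; ring
    rw [e1, e2]
    linarith

/-- Under the gap control, opinions are within distance `1` exactly when they are consecutive. -/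
lemma GapsControlled.abs_sub_le_one_iff {n : ℕ} (hn : 10 ≤ n) {s : ℝ}
    (hs : s ≤ 1 / 100 * (n : ℝ) ^ 2) {y : ℕ → ℝ} (h : GapsControlled n s y) {j k : ℕ}
    (hj : j ≤ n + 2) (hk : k ≤ n + 2) : |y j - y k| ≤ 1 ↔ j ≤ k + 1 ∧ k ≤ j + 1 := by
  have hN : (10 : ℝ) ≤ n := by exact_mod_cast hn
  have hN0 : (0 : ℝ) < n := by linarith
  set q : ℝ := 1 / n with hq
  have hq0 : 0 < q := by positivity
  have hq1 : q ≤ 1 / 10 := one_div_le_one_div_of_le (by norm_num) hN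
  have hqn : q * n = 1 := by rw [hq]; field_simp
  have bound : ∀ k : ℕ, 1 ≤ k → k ≤ n → deficitBound n s k ≤ 77 / 100 * q := fun k hk hkn => by
    have := deficitBound_le hN hs (k := k) (by exact_mod_cast hk) (by exact_mod_cast hkn)
    rwa [div_eq_mul_one_div, ← hq] at this
  have hb1 := bound 1 le_rfl (by omega)
  rw [Nat.cast_one] at hb1
  have end_gap : ∀ g : ℝ, 0 ≤ 1 - n * g → 1 - n * g ≤ deficitBound n s 1 + q →
      g ≤ q ∧ 823 / 1000 * q ≤ g := by
    intro g h0 h1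
    have hg : g = q * (n * g) := by rw [← mul_assoc, hqn, one_mul]
    constructor <;> rw [hg] <;> nlinarith
  obtain ⟨hl, hl'⟩ := end_gap _ h.left_nonneg h.left_le
  obtain ⟨hr, hr'⟩ := end_gap _ h.right_nonneg h.right_le
  have inner : ∀ k, 1 ≤ k → k ≤ n → y (k + 1) - y k ≤ 1 ∧ 1 - 77 / 100 * q ≤ y (k + 1) - y k :=
    fun k hk hkn => ⟨by linarith [h.nonneg k hk hkn],
      by linarith [h.le k hk hkn, bound k hk hkn]⟩
  have gap : ∀ k, k ≤ n + 1 → 0 < y (k + 1) - y k ∧ y (k + 1) - y k ≤ 1 := by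
    intro k hk
    rcases Nat.eq_zero_or_pos k with rfl | hk0
    · constructor <;> simp only [zero_add] <;> linarith
    rcases hk.eq_or_lt with rfl | hk1
    · constructor <;> linarith
    have := inner k hk0 (by omega)
    constructor <;> linarith
  have two : ∀ k, k ≤ n → 1 < y (k + 2) - y k := by
    intro k hk
    rcases Nat.eq_zero_or_pos k with rfl | hk0
    · have := inner 1 le_rfl (by omega)
      norm_num at this ⊢
      linarith
    rcases hk.eq_or_lt with rfl | hk1
    · have := inner k hk0 le_rfl
      linarith
    have h1 := inner k hk0 hk
    have h2 := inner (k + 1) (by omega) (by omega)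
    rw [show k + 1 + 1 = k + 2 from rfl] at h2
    linarith
  have mono : ∀ i d, i + d ≤ n + 2 → y i ≤ y (i + d) := by
    intro i d
    induction d with
    | zero => simp
    | succ d ih =>
      intro hd
      have := (gap (i + d) (by omega)).1
      rw [← add_assoc]
      linarith [ih (by omega)]
  have key : ∀ i d, i + d ≤ n + 2 → (|y (i + d) - y i| ≤ 1 ↔ d ≤ 1) := by
    intro i d hd
    rw [abs_of_nonneg (by linarith [mono i d hd])]
    constructor
    · intro hle
      by_contra! hd1
      obtain ⟨e, rfl⟩ : ∃ e, d = 2 + e := ⟨d - 2, by omega⟩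
      have := mono (i + 2) e (by omega)
      rw [← add_assoc] at hle
      linarith [two i (by omega)]
    · intro hd1
      interval_cases d
      · simp
      · exact (gap i (by omega)).2
  rcases le_total k j with hkj | hkj
  · obtain ⟨d, rfl⟩ := Nat.exists_eq_add_of_le hkj
    rw [key k d hj]; omega
  · obtain ⟨d, rfl⟩ := Nat.exists_eq_add_of_le hkj
    rw [abs_sub_comm, key j d hk]; omega

lemma dumbbellRank_le (n i : ℕ) : dumbbellRank n i ≤ n + 2 := by
  unfold dumbbellRank; split_ifs <;> omega

lemma sum_dumbbellRank (n : ℕ) (F : ℕ → ℝ) :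
    ∑ i : Fin (3 * n + 1), F (dumbbellRank n i)
      = n * F 0 + ∑ k ∈ Finset.Icc 1 (n + 1), F k + n * F (n + 2) := by
  rw [Fin.sum_univ_eq_sum_range (fun i => F (dumbbellRank n i)),
    show 3 * n + 1 = n + (n + 1) + n by ring, Finset.sum_range_add, Finset.sum_range_add]
  congr 1
  · congr 1
    · rw [Finset.sum_congr rfl (g := fun _ => F 0)]
      · simp
      · intro i hi
        rw [dumbbellRank, if_pos (Finset.mem_range.1 hi)]
    · have : Finset.Icc 1 (n + 1) = Finset.Ico (0 + 1) (n + 1 + 1) := by ext; simp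
      rw [this, ← Finset.sum_Ico_add' F 0 (n + 1) 1, Finset.range_eq_Ico]
      refine Finset.sum_congr rfl fun i hi => ?_
      rw [Finset.mem_Ico] at hi
      rw [dumbbellRank, if_neg (by omega), if_pos (by omega)]
      congr 1
      omega
  · rw [Finset.sum_congr rfl (g := fun _ => F (n + 2))]
    · simp
    · intro i hi
      rw [dumbbellRank, if_neg (by omega), if_neg (by omega)]

/-- Summing over the agents whose rank is within `1` of `c`. -/
lemma sum_ite_dumbbellRank {n : ℕ} (hn : 3 ≤ n) (F : ℕ → ℝ) {c : ℕ} (hc : c ≤ n + 2) :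
    ∑ i : Fin (3 * n + 1), (if dumbbellRank n i ≤ c + 1 ∧ c ≤ dumbbellRank n i + 1
        then F (dumbbellRank n i) else 0)
      = if c = 0 then n * F 0 + F 1
        else if c = 1 then n * F 0 + F 1 + F 2
        else if c = n + 1 then F n + F (n + 1) + n * F (n + 2)
        else if c = n + 2 then F (n + 1) + n * F (n + 2)
        else F (c - 1) + F c + F (c + 1) := by
  rw [sum_dumbbellRank n (fun k => if k ≤ c + 1 ∧ c ≤ k + 1 then F k else 0)]
  have inner : ∀ S : Finset ℕ, (∀ k, k ∈ S ↔ (1 ≤ k ∧ k ≤ n + 1) ∧ k ≤ c + 1 ∧ c ≤ k + 1) →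
      ∑ k ∈ Finset.Icc 1 (n + 1), (if k ≤ c + 1 ∧ c ≤ k + 1 then F k else 0) = ∑ k ∈ S, F k := by
    intro S hS
    rw [← Finset.sum_filter]
    congr 1
    ext k
    simp [hS]
  by_cases h0 : c = 0
  · rw [inner {1} (by intro k; simp; omega)]
    simp [h0]
  by_cases h1 : c = 1
  · rw [inner {1, 2} (by intro k; simp; omega)]
    simp [h1, show ¬ n + 2 ≤ 2 by omega, add_assoc]
  by_cases h2 : c = n + 1
  · rw [inner {n, n + 1} (by intro k; simp; omega)]
    simp [h2, show n ≠ 0 by omega]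
  by_cases h3 : c = n + 2
  · rw [inner {n + 1} (by intro k; simp; omega)]
    simp [h3]
  rw [inner {c - 1, c, c + 1} (by intro k; simp; omega),
    Finset.sum_insert (by simp; omega), Finset.sum_insert (by simp), Finset.sum_singleton]
  simp [h0, h1, h2, h3, show ¬ c ≤ 1 by omega, show ¬ n + 2 ≤ c + 1 by omega, add_assoc]

lemma hkStep_dumbbell {n : ℕ} (hn : 10 ≤ n) {s : ℝ} (hs : s ≤ 1 / 100 * (n : ℝ) ^ 2)
    {y : ℕ → ℝ} (h : GapsControlled n s y) (i : Fin (3 * n + 1)) :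
    hkStep (fun j : Fin (3 * n + 1) => y (dumbbellRank n j)) i
      = dumbbellStep n y (dumbbellRank n i) := by
  have hc := dumbbellRank_le n i
  have hsum := sum_ite_dumbbellRank (by omega : 3 ≤ n) y hc
  have hcard := sum_ite_dumbbellRank (by omega : 3 ≤ n) (fun _ => 1) hc
  unfold hkStep
  simp only [h.abs_sub_le_one_iff hn hs (dumbbellRank_le n _) hc]
  rw [Finset.card_filter, Finset.sum_filter, Nat.cast_sum]
  simp only [Nat.cast_ite, Nat.cast_one, Nat.cast_zero]
  rw [hsum, hcard]
  unfold dumbbellStep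
  split_ifs <;> norm_num <;> ring

lemma gapsControlled_init {n : ℕ} (hn : 3 ≤ n) :
    ∃ y : ℕ → ℝ, GapsControlled n 0 y ∧ ∀ i : Fin (3 * n + 1), y (dumbbellRank n i) =
      if (i : ℕ) + 1 ≤ n then -(1 / (n : ℝ))
      else if (i : ℕ) + 1 ≤ 2 * n + 1 then ((i : ℕ) + 1 : ℝ) - ((n : ℝ) + 1)
      else (n : ℝ) + 1 / (n : ℝ) := by
  have hN0 : (0 : ℝ) < n := by exact_mod_cast (by omega : 0 < n)
  have hB : ∀ k, 0 ≤ deficitBound n 0 k := fun k => deficitBound_nonneg hN0 le_rfl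
  refine ⟨fun k => if k = 0 then -(1 / (n : ℝ)) else if k ≤ n + 1 then (k : ℝ) - 1
    else n + 1 / n, ?_, ?_⟩
  · have hl : 1 - (n : ℝ) * (0 - -(1 / n)) = 0 := by field_simp; ring
    have hr : 1 - (n : ℝ) * (n + 1 / n - n) = 0 := by field_simp; ring
    have hb := hB 1
    constructor
    · simpa using hl.ge
    · simp only [one_ne_zero, if_true, if_false, show 1 ≤ n + 1 by omega, Nat.cast_one, sub_self]
      rw [hl]; positivity
    · simpa using hr.ge
    · have : (0 : ℝ) ≤ deficitBound n 0 1 + 1 / n := by positivity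
      simpa using hr.le.trans this
    · intro k hk hkn
      simp [show k ≠ 0 by omega, hkn, show k ≤ n + 1 by omega]
    · intro k hk hkn
      simpa [show k ≠ 0 by omega, hkn, show k ≤ n + 1 by omega] using hB k
  · intro i
    have hi := i.2
    unfold dumbbellRank
    split_ifs <;> try omega
    all_goals simp_all
    intro
    omega

lemma exists_gapsControlled {n : ℕ} (hn : 10 ≤ n) {x : ℕ → Fin (3 * n + 1) → ℝ}
    (hx0 : ∀ i : Fin (3 * n + 1), x 0 i =
      if (i : ℕ) + 1 ≤ n then -(1 / (n : ℝ))
      else if (i : ℕ) + 1 ≤ 2 * n + 1 then ((i : ℕ) + 1 : ℝ) - ((n : ℝ) + 1)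
      else (n : ℝ) + 1 / (n : ℝ))
    (hx : ∀ t, x (t + 1) = hkStep (x t)) (t : ℕ) (ht : (t : ℝ) ≤ 1 / 100 * (n : ℝ) ^ 2) :
    ∃ y : ℕ → ℝ, GapsControlled n t y ∧ x t = fun i : Fin (3 * n + 1) => y (dumbbellRank n i) := by
  induction t with
  | zero =>
    obtain ⟨y, hy, h⟩ := gapsControlled_init (by omega : 3 ≤ n)
    exact ⟨y, by simpa using hy, funext fun i => (hx0 i).trans (h i).symm⟩
  | succ t ih =>
    push_cast at ht ⊢
    obtain ⟨y, hy, h⟩ := ih (by linarith)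
    exact ⟨_, hy.step (by omega) t.cast_nonneg, by
      rw [hx, h]; exact funext fun i => hkStep_dumbbell hn (by linarith) hy i⟩

/-- The dumbbell configuration `D_n` on `3n+1` agents (agent `i : Fin (3n+1)`
has 1-indexed label `i+1`): `n` agents at `-1/n`, single agents at
`0, 1, …, n`, and `n` agents at `n + 1/n`.  There is an absolute constant
`c₃ > 0` such that, for every even `n ≥ 3` (in fact `n ≥ 4`), `D_n` is not
frozen at any time `t ≤ c₃·n²`; hence `f₁(m) = Ω(m²)`. -/
theorem stmt_18 : ∃ c₃ : ℝ, 0 < c₃ ∧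
    ∀ (n : ℕ), 3 ≤ n → Even n →
    ∀ (x : ℕ → Fin (3 * n + 1) → ℝ),
    (∀ i : Fin (3 * n + 1), x 0 i =
      if (i : ℕ) + 1 ≤ n then -(1 / (n : ℝ))
      else if (i : ℕ) + 1 ≤ 2 * n + 1 then ((i : ℕ) + 1 : ℝ) - ((n : ℝ) + 1)
      else (n : ℝ) + 1 / (n : ℝ)) →
    (∀ t, x (t + 1) = hkStep (x t)) →
    ∀ t : ℕ, (t : ℝ) ≤ c₃ * (n : ℝ) ^ 2 →
      ¬ ∀ a b : Fin (3 * n + 1), x t a ≠ x t b → 1 < |x t a - x t b| := by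
  refine ⟨1 / 100, by norm_num, fun n hn _ x hx0 hx t ht hfr => ?_⟩
  specialize hfr ⟨n + 1, by omega⟩ ⟨n, by omega⟩
  by_cases hn10 : 10 ≤ n
  · obtain ⟨y, hy, h⟩ := exists_gapsControlled hn10 hx0 hx t ht
    have hle := (hy.abs_sub_le_one_iff hn10 ht (j := 2) (k := 1) (by omega) (by omega)).2
      (by omega)
    have hlow := hy.le 1 le_rfl (by omega)
    have hN : (10 : ℝ) ≤ n := by exact_mod_cast hn10
    have hb := deficitBound_le hN ht (k := (1 : ℕ)) (by simp) (by push_cast; linarith)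
    have hb' : 77 / 100 / (n : ℝ) < 1 := by rw [div_lt_one] <;> linarith
    have r2 : dumbbellRank n (n + 1) = 2 := by
      rw [dumbbellRank, if_neg (by omega), if_pos (by omega)]; omega
    have r1 : dumbbellRank n n = 1 := by
      rw [dumbbellRank, if_neg (by omega), if_pos (by omega)]; omega
    simp only [h, r1, r2] at hfr
    rw [Nat.cast_one] at hlow hb
    have hne : y 2 ≠ y 1 := fun heq => by
      rw [show 1 + 1 = 2 from rfl, heq] at hlow
      linarith
    linarith [hfr hne]
  · have hN : (n : ℝ) ≤ 9 := by exact_mod_cast (by omega : n ≤ 9)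
    have ht0 : t = 0 := by
      have : (t : ℝ) < 1 := by nlinarith [n.cast_nonneg (α := ℝ)]
      exact Nat.lt_one_iff.1 (by exact_mod_cast this)
    subst ht0
    have e1 : x 0 ⟨n + 1, by omega⟩ = 1 := by
      rw [hx0]
      simp only [Nat.cast_add, Nat.cast_one]
      rw [if_neg (by omega), if_pos (by omega)]; ring
    have e0 : x 0 ⟨n, by omega⟩ = 0 := by
      rw [hx0]
      rw [if_neg (by simp), if_pos (by simp; omega)]; simp
    rw [e1, e0] at hfr
    norm_num at hfr
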